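/- arXiv:1807.00109 — 2 statements merged into one kernel-verified Lean document; each statement's English description precedes it below -/
import Mathlib

section
/- Let Γ be a group and let 𝔾 = (G⃗, ψ) be a Γ-labeled graph with two distinct vertices s, t such that 𝔾 is connected and balanced, and assume every arc of G⃗ incident to s leaves s. Then there exists α ∈ Γ (namely the common label α = l(𝔾;s,t) of all s–t paths) such that 𝔾 is (s,t)-equivalent to the Γ-labeled graph 𝔾' = (G⃗, ψ') defined by ψ'(e⃗) = α for every arc e⃗ incident to s, and ψ'(e⃗) = 1_Γ for every other arc. -/
/-- A Γ-labeled graph: a finite loopless directed multigraph with arcs labeled by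
elements of a group Γ.  An arc is represented as a triple `(tail, head, label)`. -/
structure LGraph (V : Type) (Γ : Type) [Group Γ] where
  verts : Set V
  arcs : Set (V × V × Γ)
  verts_finite : verts.Finite
  arcs_finite : arcs.Finite
  tail_mem : ∀ a ∈ arcs, a.1 ∈ verts
  head_mem : ∀ a ∈ arcs, a.2.1 ∈ verts
  loopless : ∀ a ∈ arcs, a.1 ≠ a.2.1

namespace LGraph

variable {V : Type} {Γ : Type} [Group Γ]

/-- `connects a u v` : the arc `a` joins `u` and `v` (traversed from `u` to `v`,
in either direction of the arc). -/
def connects (a : V × V × Γ) (u v : V) : Prop :=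
  (a.1 = u ∧ a.2.1 = v) ∨ (a.1 = v ∧ a.2.1 = u)

/-- Walks in the underlying undirected graph of a Γ-labeled graph. -/
inductive Walk (G : LGraph V Γ) : V → V → Type
  | nil (v : V) : Walk G v v
  | cons (u v : V) {w : V} (a : V × V × Γ) (ha : a ∈ G.arcs)
      (hstep : connects a u v) (W : Walk G v w) : Walk G u w

variable [DecidableEq V]

/-- `ψ_𝔾(e, v)` : the label contributed by arc `a` when traversed arriving at `v` :
the arc's label if the arc enters `v`, its inverse if it leaves `v`. -/
def stepLabel (v : V) (a : V × V × Γ) : Γ :=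
  if a.2.1 = v then a.2.2 else a.2.2⁻¹

namespace Walk

variable {G : LGraph V Γ}

/-- The label `ψ_𝔾(W)` of a walk: the product of the step labels, later steps
multiplied on the left. -/
def label : {u w : V} → G.Walk u w → Γ
  | _, _, .nil _ => 1
  | _, _, .cons _ v a _ _ W => label W * stepLabel v a

/-- The list of vertices of a walk, in order. -/
def support : {u w : V} → G.Walk u w → List V
  | _, _, .nil v => [v]
  | _, _, .cons u _ _ _ _ W => u :: support W

/-- The list of traversed arcs of a walk, in order. -/
def arcsList : {u w : V} → G.Walk u w → List (V × V × Γ)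
  | _, _, .nil _ => []
  | _, _, .cons _ _ a _ _ W => a :: arcsList W

/-- The length (number of edges) of a walk. -/
def length : {u w : V} → G.Walk u w → ℕ
  | _, _, .nil _ => 0
  | _, _, .cons _ _ _ _ _ W => length W + 1

/-- A walk is a path if all its vertices are distinct. -/
def IsPath {u w : V} (W : G.Walk u w) : Prop := W.support.Nodup

/-- A closed walk is a cycle if it is nonempty, its edges are distinct and its
vertices (except for the repeated end vertex) are distinct. -/
def IsCycle {v : V} (W : G.Walk v v) : Prop :=
  1 ≤ W.length ∧ W.arcsList.Nodup ∧ W.support.dropLast.Nodup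

end Walk

/-- `l(𝔾; s, t)` : the set of all labels of s–t paths in `G`. -/
def labelSet (G : LGraph V Γ) (s t : V) : Set Γ :=
  {γ | ∃ P : G.Walk s t, P.IsPath ∧ P.label = γ}

/-- A Γ-labeled graph is balanced if every cycle has label `1`. -/
def Balanced (G : LGraph V Γ) : Prop :=
  ∀ (v : V) (C : G.Walk v v), C.IsCycle → C.label = 1

/-- Connectivity of (the underlying graph of) a Γ-labeled graph. -/
def Connected (G : LGraph V Γ) : Prop :=
  ∀ u ∈ G.verts, ∀ w ∈ G.verts, Nonempty (G.Walk u w)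

/-- `G` has no pair of equivalent arcs: no two distinct arcs that are parallel with
the same label, or antiparallel with mutually inverse labels. -/
def NoEquivArcs (G : LGraph V Γ) : Prop :=
  ∀ a ∈ G.arcs, ∀ b ∈ G.arcs, a ≠ b →
    ¬ ((a.1 = b.1 ∧ a.2.1 = b.2.1 ∧ a.2.2 = b.2.2) ∨
       (a.1 = b.2.1 ∧ a.2.1 = b.1 ∧ a.2.2 = b.2.2⁻¹))

/-- `(𝔾, s, t) ∈ 𝒟` : `s, t` are distinct vertices, every vertex lies on some
s–t path, and there are no equivalent arcs. -/
def MemD (G : LGraph V Γ) (s t : V) : Prop :=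
  s ≠ t ∧ s ∈ G.verts ∧ t ∈ G.verts ∧
  (∀ v ∈ G.verts, ∃ P : G.Walk s t, P.IsPath ∧ v ∈ P.support) ∧
  G.NoEquivArcs

/-- `(s,t)`-equivalence: `H` is obtained from `G` by shifting by `φ v` at each
vertex `v`, where `φ` vanishes at `s` and `t`. -/
def STEquiv (s t : V) (G H : LGraph V Γ) : Prop :=
  ∃ φ : V → Γ, φ s = 1 ∧ φ t = 1 ∧ H.verts = G.verts ∧
    H.arcs = (fun a : V × V × Γ => (a.1, a.2.1, φ a.2.1 * a.2.2 * (φ a.1)⁻¹)) '' G.arcs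

/-- The subgraph induced by a vertex set `X`. -/
def induce (G : LGraph V Γ) (X : Set V) : LGraph V Γ where
  verts := G.verts ∩ X
  arcs := {a ∈ G.arcs | a.1 ∈ X ∧ a.2.1 ∈ X}
  verts_finite := G.verts_finite.subset Set.inter_subset_left
  arcs_finite := G.arcs_finite.subset fun _ ha => ha.1
  tail_mem := fun a ha => ⟨G.tail_mem a ha.1, ha.2.1⟩
  head_mem := fun a ha => ⟨G.head_mem a ha.1, ha.2.2⟩
  loopless := fun a ha => G.loopless a ha.1

/-- `𝔾 − Y` : deletion of the vertex set `Y`. -/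
def delete (G : LGraph V Γ) (Y : Set V) : LGraph V Γ := G.induce Yᶜ

/-- `N_𝔾(X)` : the set of vertices outside `X` adjacent to `X`. -/
def nbhd (G : LGraph V Γ) (X : Set V) : Set V :=
  {y | y ∉ X ∧ ∃ x ∈ X, ∃ a ∈ G.arcs, connects a x y}

/-- `𝔾⟦X⟧` : the subgraph induced by `X ∪ N(X)` with the edges inside `N(X)` removed. -/
def around (G : LGraph V Γ) (X : Set V) : LGraph V Γ where
  verts := G.verts ∩ (X ∪ G.nbhd X)
  arcs := {a ∈ G.arcs | (a.1 ∈ X ∪ G.nbhd X) ∧ (a.2.1 ∈ X ∪ G.nbhd X) ∧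
            ¬ (a.1 ∈ G.nbhd X ∧ a.2.1 ∈ G.nbhd X)}
  verts_finite := G.verts_finite.subset Set.inter_subset_left
  arcs_finite := G.arcs_finite.subset fun _ ha => ha.1
  tail_mem := fun a ha => ⟨G.tail_mem a ha.1, ha.2.1⟩
  head_mem := fun a ha => ⟨G.head_mem a ha.1, ha.2.2.1⟩
  loopless := fun a ha => G.loopless a ha.1

/-- The arcs of `G` surviving the removal of the vertex set `X`. -/
def keptArcs (G : LGraph V Γ) (X : Set V) : Set (V × V × Γ) :=
  {a ∈ G.arcs | a.1 ∉ X ∧ a.2.1 ∉ X}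

/-- `A` contains an arc equivalent to an arc from `x` to `y` with label `γ`. -/
def hasEquivArc (A : Set (V × V × Γ)) (x y : V) (γ : Γ) : Prop :=
  (x, y, γ) ∈ A ∨ (y, x, γ⁻¹) ∈ A

/-- The new arcs added by a contraction of `X`, between `x` and `y`: an arc from `x`
to `y` with label `γ` for each `γ ∈ l(𝔾⟦X⟧; x, y)`, unless an equivalent arc
already exists among the kept arcs. -/
def newContractionArcs (G : LGraph V Γ) (X : Set V) (x y : V) : Set (V × V × Γ) :=
  {p | ∃ γ ∈ labelSet (G.around X) x y, p = (x, y, γ) ∧ ¬ hasEquivArc (G.keptArcs X) x y γ}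

/-- The arc set of the 2-contraction `𝔾 /₂ X`, where `N_𝔾(X) = {x, y}`. -/
def contract2Arcs (G : LGraph V Γ) (X : Set V) (x y : V) : Set (V × V × Γ) :=
  G.keptArcs X ∪ G.newContractionArcs X x y

/-- The arc set of the 3-contraction `𝔾 /₃ X`, where `N_𝔾(X) = {x, y, z}`. -/
def contract3Arcs (G : LGraph V Γ) (X : Set V) (x y z : V) : Set (V × V × Γ) :=
  G.keptArcs X ∪ G.newContractionArcs X x y ∪ G.newContractionArcs X y z ∪
    G.newContractionArcs X x z

/-- `X` is 2-contractible in `𝔾` (w.r.t. the terminals `s, t`). -/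
def TwoContractible (G : LGraph V Γ) (s t : V) (X : Set V) : Prop :=
  X ⊆ G.verts \ {s, t} ∧
  (∃ x y : V, x ≠ y ∧ G.nbhd X = {x, y}) ∧
  (G.around X).Connected ∧ G.around X ≠ G

/-- `X` is 3-contractible in `𝔾` (w.r.t. the terminals `s, t`). -/
def ThreeContractible (G : LGraph V Γ) (s t : V) (X : Set V) : Prop :=
  X ⊆ G.verts \ {s, t} ∧
  (∃ x y z : V, x ≠ y ∧ x ≠ z ∧ y ≠ z ∧ G.nbhd X = {x, y, z}) ∧
  (G.induce X).Connected ∧ (G.around X).Balanced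

/-- The graph obtained by adding a single `s`–`t` edge (with an arbitrary label). -/
def addEdge (G : LGraph V Γ) (s t : V) (hs : s ∈ G.verts) (ht : t ∈ G.verts)
    (hst : s ≠ t) : LGraph V Γ where
  verts := G.verts
  arcs := insert (s, t, (1 : Γ)) G.arcs
  verts_finite := G.verts_finite
  arcs_finite := G.arcs_finite.insert _
  tail_mem := by
    intro a ha
    rcases Set.mem_insert_iff.mp ha with rfl | h
    · exact hs
    · exact G.tail_mem a h
  head_mem := by
    intro a ha
    rcases Set.mem_insert_iff.mp ha with rfl | h
    · exact ht
    · exact G.head_mem a h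
  loopless := by
    intro a ha
    rcases Set.mem_insert_iff.mp ha with rfl | h
    · exact hst
    · exact G.loopless a h

/-- 2-connectivity: more than 2 vertices, and removing any single vertex leaves
the graph connected. -/
def TwoConnected (G : LGraph V Γ) : Prop :=
  2 < G.verts.ncard ∧ ∀ v : V, (G.delete {v}).Connected

/-- The effect of shifting by `α` at `v` on a single arc. -/
def shiftArc (v : V) (α : Γ) (a : V × V × Γ) : V × V × Γ :=
  (a.1, a.2.1, if a.2.1 = v then α * a.2.2 else if a.1 = v then a.2.2 * α⁻¹ else a.2.2)

/-- The graph obtained from `G` by shifting by `α` at `v`. -/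
def shift (G : LGraph V Γ) (v : V) (α : Γ) : LGraph V Γ where
  verts := G.verts
  arcs := shiftArc v α '' G.arcs
  verts_finite := G.verts_finite
  arcs_finite := G.arcs_finite.image _
  tail_mem := by rintro a ⟨b, hb, rfl⟩; exact G.tail_mem b hb
  head_mem := by rintro a ⟨b, hb, rfl⟩; exact G.head_mem b hb
  loopless := by rintro a ⟨b, hb, rfl⟩; exact G.loopless b hb

/-- The walk in `G.shift v α` corresponding to a walk in `G`. -/
def Walk.shiftMap {G : LGraph V Γ} (v : V) (α : Γ) :
    {u w : V} → G.Walk u w → (G.shift v α).Walk u w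
  | _, _, .nil x => .nil x
  | _, _, .cons u x a ha hstep W =>
      .cons u x (shiftArc v α a) (Set.mem_image_of_mem _ ha) hstep (Walk.shiftMap v α W)

end LGraph
namespace LGraph

variable {V Γ : Type} [Group Γ] {G : LGraph V Γ}

namespace Walk

/-- Concatenation of walks. -/
def append : {u v w : V} → G.Walk u v → G.Walk v w → G.Walk u w
  | _, _, _, .nil _, W' => W'
  | _, _, _, .cons u x a ha h W, W' => .cons u x a ha h (append W W')

theorem start_mem_support {u v : V} (W : G.Walk u v) : u ∈ W.support := by
  cases W <;> simp [support]

theorem end_mem_support {u v : V} (W : G.Walk u v) : v ∈ W.support := by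
  induction W with
  | nil => simp [support]
  | cons u x a ha h W ih => simp [support, ih]

theorem mem_support_of_mem_arcsList {u v : V} (W : G.Walk u v) {a : V × V × Γ}
    (ha : a ∈ W.arcsList) : a.1 ∈ W.support ∧ a.2.1 ∈ W.support := by
  induction W with
  | nil => simp [arcsList] at ha
  | cons u x b hb h W ih =>
    have hx := W.start_mem_support
    simp only [arcsList, List.mem_cons] at ha
    simp only [support, List.mem_cons]
    rcases ha with rfl | ha
    · rcases h with ⟨rfl, rfl⟩ | ⟨rfl, rfl⟩ <;> simp [hx]
    · exact ⟨.inr (ih ha).1, .inr (ih ha).2⟩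

theorem IsPath.of_cons {u v w : V} {a : V × V × Γ} {ha : a ∈ G.arcs} {h : connects a u v}
    {W : G.Walk v w} (hW : (cons u v a ha h W).IsPath) : u ∉ W.support ∧ W.IsPath :=
  List.nodup_cons.mp hW

theorem IsPath.arcsList_nodup {u v : V} {W : G.Walk u v} (hW : W.IsPath) :
    W.arcsList.Nodup := by
  induction W with
  | nil => simp [arcsList]
  | cons u x a ha h W ih =>
    obtain ⟨hu, hW⟩ := hW.of_cons
    refine List.nodup_cons.mpr ⟨fun hmem => hu ?_, ih hW⟩
    have := W.mem_support_of_mem_arcsList hmem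
    rcases h with ⟨rfl, -⟩ | ⟨-, rfl⟩
    exacts [this.1, this.2]

theorem support_eq_dropLast_append {u v : V} (W : G.Walk u v) :
    W.support = W.support.dropLast ++ [v] := by
  induction W with
  | nil => simp [support]
  | cons u x a ha h W ih =>
    rw [support, List.dropLast_cons_of_ne_nil (List.ne_nil_of_mem W.start_mem_support),
      List.cons_append, ← ih]

variable [DecidableEq V]

theorem label_append {u v w : V} (W : G.Walk u v) (W' : G.Walk v w) :
    (W.append W').label = W'.label * W.label := by
  induction W with
  | nil => simp [append, label]
  | cons u x a ha h W ih => simp [append, label, ih, mul_assoc]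

theorem IsPath.label_eq_one {u : V} {W : G.Walk u u} (hW : W.IsPath) : W.label = 1 := by
  cases W with
  | nil => rfl
  | cons _ x a ha h W => exact absurd W.end_mem_support hW.of_cons.1

theorem exists_split {u w x : V} (W : G.Walk u w) (hx : x ∈ W.support) :
    ∃ (Q : G.Walk u x) (R : G.Walk x w), W.label = R.label * Q.label ∧
      Q.support.Sublist W.support ∧ R.support.Sublist W.support := by
  induction W with
  | nil v =>
    obtain rfl : x = v := by simpa [support] using hx
    exact ⟨.nil x, .nil x, by simp [label], .refl _, .refl _⟩
  | cons u y a ha h W ih =>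
    by_cases hxu : x = u
    · subst hxu
      exact ⟨.nil x, .cons x y a ha h W, by simp [label], by simp [support], .refl _⟩
    · obtain ⟨Q, R, hl, hQ, hR⟩ := ih (by simpa [support, hxu] using hx)
      exact ⟨.cons u y a ha h Q, R, by simp [label, hl, mul_assoc], hQ.cons_cons _, hR.cons _⟩

end Walk

theorem eq_of_connects_of_connects {a : V × V × Γ} (ha : a ∈ G.arcs) {u v x : V}
    (h : connects a u v) (h' : connects a v x) : x = u := by
  have := G.loopless a ha
  unfold connects at h h'
  grind

variable [DecidableEq V]

theorem stepLabel_mul_stepLabel_of_connects {a : V × V × Γ} (ha : a ∈ G.arcs) {u v : V}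
    (h : connects a u v) : stepLabel u a * stepLabel v a = 1 := by
  have := G.loopless a ha
  rcases h with ⟨rfl, rfl⟩ | ⟨rfl, rfl⟩ <;> simp [stepLabel, this.symm]

theorem Balanced.label_path_mul_stepLabel (hbal : G.Balanced) {u v : V} {a : V × V × Γ}
    (ha : a ∈ G.arcs) (h : connects a u v) {Q : G.Walk v u} (hQ : Q.IsPath) :
    Q.label * stepLabel v a = 1 := by
  by_cases hmem : a ∈ Q.arcsList
  · cases Q with
    | nil => simp [Walk.arcsList] at hmem
    | cons _ x b hb h' Q =>
      obtain ⟨hv, hQ'⟩ := hQ.of_cons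
      rcases List.mem_cons.mp hmem with rfl | hmem
      · obtain rfl := eq_of_connects_of_connects ha h h'
        simpa [Walk.label, hQ'.label_eq_one] using stepLabel_mul_stepLabel_of_connects ha h
      · have := Q.mem_support_of_mem_arcsList hmem
        rcases h with ⟨-, rfl⟩ | ⟨rfl, -⟩
        exacts [absurd this.2 hv, absurd this.1 hv]
  · refine hbal u (.cons u v a ha h Q)
      ⟨by simp [Walk.length], List.nodup_cons.mpr ⟨hmem, hQ.arcsList_nodup⟩, ?_⟩
    rw [Walk.support, List.dropLast_cons_of_ne_nil (List.ne_nil_of_mem Q.start_mem_support)]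
    have hnd : Q.support.Nodup := hQ
    rw [Q.support_eq_dropLast_append] at hnd
    exact (List.perm_append_singleton _ _).nodup_iff.mp hnd

theorem Balanced.exists_isPath_label_eq (hbal : G.Balanced) {u w : V} (W : G.Walk u w) :
    ∃ P : G.Walk u w, P.IsPath ∧ P.label = W.label := by
  induction W with
  | nil v => exact ⟨.nil v, by simp [Walk.IsPath, Walk.support], rfl⟩
  | cons u v a ha h W ih =>
    obtain ⟨P, hP, hl⟩ := ih
    by_cases hu : u ∈ P.support
    · obtain ⟨Q, R, hQR, hQ, hR⟩ := P.exists_split hu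
      refine ⟨R, hR.nodup hP, ?_⟩
      rw [Walk.label, ← hl, hQR, mul_assoc,
        hbal.label_path_mul_stepLabel ha h (hQ.nodup hP), mul_one]
    · exact ⟨.cons u v a ha h P, List.nodup_cons.mpr ⟨hu, hP⟩, by simp [Walk.label, hl]⟩

theorem Balanced.label_closed (hbal : G.Balanced) {u : V} (W : G.Walk u u) : W.label = 1 := by
  obtain ⟨P, hP, hl⟩ := hbal.exists_isPath_label_eq W
  rw [← hl, hP.label_eq_one]

theorem Balanced.label_eq_label (hbal : G.Balanced) (hconn : G.Connected) {u w : V}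
    (hu : u ∈ G.verts) (hw : w ∈ G.verts) (W W' : G.Walk u w) : W.label = W'.label := by
  obtain ⟨C⟩ := hconn w hw u hu
  have h := hbal.label_closed (W.append C)
  rw [← hbal.label_closed (W'.append C), Walk.label_append, Walk.label_append] at h
  exact mul_left_cancel h

/-- A connected balanced graph has a potential whose differences are the arc labels. -/
theorem Balanced.exists_potential (hbal : G.Balanced) (hconn : G.Connected) {s : V}
    (hs : s ∈ G.verts) :
    ∃ p : V → Γ, (∀ v ∈ G.verts, ∀ W : G.Walk s v, W.label = p v) ∧
      ∀ a ∈ G.arcs, p a.2.1 = a.2.2 * p a.1 := by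
  have hex : ∀ v, ∃ γ : Γ, v ∈ G.verts → ∀ W : G.Walk s v, W.label = γ := by
    intro v
    by_cases hv : v ∈ G.verts
    · obtain ⟨W₀⟩ := hconn s hs v hv
      exact ⟨W₀.label, fun _ W => hbal.label_eq_label hconn hs hv W W₀⟩
    · exact ⟨1, fun h => absurd h hv⟩
  choose p hp using hex
  refine ⟨p, hp, fun a ha => ?_⟩
  obtain ⟨W⟩ := hconn s hs a.1 (G.tail_mem a ha)
  rw [← hp _ (G.tail_mem a ha) W, ← hp _ (G.head_mem a ha)
    (W.append (.cons a.1 a.2.1 a ha (.inl ⟨rfl, rfl⟩) (.nil _))), Walk.label_append]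
  simp [Walk.label, stepLabel]

end LGraph

open LGraph in
/-- If a Γ-labeled graph `G` with distinct vertices `s, t` is connected
and balanced, and all arcs around `s` leave `s`, then there is `α ∈ Γ` (namely the
common label of all s–t paths) such that `G` is (s,t)-equivalent to the graph with
the same underlying digraph in which every arc incident to `s` has label `α` and
every other arc has label `1`. -/
theorem balanced_st_equivalent_normal_form {V Γ : Type} [Group Γ] [DecidableEq V]
    (G : LGraph V Γ) (s t : V)
    (hs : s ∈ G.verts) (ht : t ∈ G.verts) (hst : s ≠ t)
    (hconn : G.Connected) (hbal : G.Balanced)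
    (hleave : ∀ a ∈ G.arcs, a.2.1 ≠ s) :
    ∃ α : Γ, labelSet G s t = {α} ∧
      ∃ G' : LGraph V Γ, STEquiv s t G G' ∧
        G'.arcs = (fun a : V × V × Γ =>
          (a.1, a.2.1, if a.1 = s ∨ a.2.1 = s then α else (1 : Γ))) '' G.arcs := by
  obtain ⟨p, hp, hpa⟩ := hbal.exists_potential hconn hs
  have hps : p s = 1 := (hp s hs (.nil s)).symm
  refine ⟨p t, ?_, ?_⟩
  · ext γ
    constructor
    · rintro ⟨P, -, rfl⟩
      exact hp t ht P
    · rintro rfl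
      obtain ⟨W⟩ := hconn s hs t ht
      obtain ⟨P, hP, -⟩ := hbal.exists_isPath_label_eq W
      exact ⟨P, hP, hp t ht P⟩
  · let f : V × V × Γ → V × V × Γ := fun a =>
      (a.1, a.2.1, if a.1 = s ∨ a.2.1 = s then p t else 1)
    refine ⟨{ verts := G.verts
              arcs := f '' G.arcs
              verts_finite := G.verts_finite
              arcs_finite := G.arcs_finite.image _
              tail_mem := by rintro _ ⟨b, hb, rfl⟩; exact G.tail_mem b hb
              head_mem := by rintro _ ⟨b, hb, rfl⟩; exact G.head_mem b hb
              loopless := by rintro _ ⟨b, hb, rfl⟩; exact G.loopless b hb },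
      ⟨fun v => if v = s then 1 else p t * (p v)⁻¹, by simp, by simp [hst.symm], rfl, ?_⟩, rfl⟩
    refine Set.image_congr fun a ha => ?_
    have hhead := hleave a ha
    by_cases htail : a.1 = s
    · simp [f, hhead, htail, hpa a ha, hps]
    · simp [f, hhead, htail, hpa a ha, mul_assoc]
end

section
/- Let Γ be a group, (𝔾, s, t) ∈ 𝒟, and let X ⊆ V(𝔾)∖{s,t} be a 3-contractible vertex set in 𝔾. Then (𝔾 /₃ X, s, t) ∈ 𝒟 and l(𝔾 /₃ X; s, t) = l(𝔾; s, t). -/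
namespace LGraph

theorem connects.symm {V Γ : Type} {a : V × V × Γ} {u v : V} (h : connects a u v) :
    connects a v u :=
  Or.symm h

theorem connects.right_unique {V Γ : Type} {a : V × V × Γ} {u v w : V} (h : connects a u v)
    (h' : connects a u w) : v = w := by
  rcases h with ⟨h1, h2⟩ | ⟨h1, h2⟩ <;> rcases h' with ⟨h3, h4⟩ | ⟨h3, h4⟩ <;>
    simp_all

variable {V : Type} {Γ : Type} [Group Γ]

theorem Walk.start_mem_support_s5 {G : LGraph V Γ} {u w : V} (W : G.Walk u w) : u ∈ W.support := by
  cases W <;> simp [Walk.support]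

theorem Walk.end_mem_support_s5 {G : LGraph V Γ} {u w : V} (W : G.Walk u w) : w ∈ W.support := by
  induction W <;> simp_all [Walk.support]

theorem Walk.support_ne_nil {G : LGraph V Γ} {u w : V} (W : G.Walk u w) : W.support ≠ [] :=
  List.ne_nil_of_mem W.start_mem_support_s5

theorem Walk.left_mem_support_of_mem_arcsList {G : LGraph V Γ} {u w p q : V}
    {W : G.Walk u w} {a : V × V × Γ} (ha : a ∈ W.arcsList) (hc : connects a p q) : p ∈ W.support := by
  induction W with
  | nil => simp [Walk.arcsList] at ha
  | cons u v b hb hs W ih =>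
    rcases List.mem_cons.1 ha with rfl | ha
    · have := W.start_mem_support_s5
      rcases hc with ⟨rfl, rfl⟩ | ⟨rfl, rfl⟩ <;> rcases hs with ⟨rfl, rfl⟩ | ⟨rfl, rfl⟩ <;>
        simp_all [Walk.support]
    · exact List.mem_cons_of_mem _ (ih ha)

theorem Walk.IsPath.arcsList_nodup_s5 {G : LGraph V Γ} {u w : V} {P : G.Walk u w} (hP : P.IsPath) :
    P.arcsList.Nodup := by
  induction P with
  | nil => simp [Walk.arcsList]
  | cons u v b hb hs W ih =>
    have h := List.nodup_cons.1 hP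
    exact List.nodup_cons.2 ⟨fun hm => h.1 (Walk.left_mem_support_of_mem_arcsList hm hs), ih h.2⟩

theorem Walk.support_eq_dropLast_append_s5 {G : LGraph V Γ} {u w : V} (W : G.Walk u w) :
    W.support = W.support.dropLast ++ [w] := by
  induction W with
  | nil => simp [Walk.support]
  | cons u v b hb hs W ih =>
    rw [Walk.support, List.dropLast_cons_of_ne_nil W.support_ne_nil, List.cons_append, ← ih]

theorem induce_arcs_subset {G : LGraph V Γ} (X : Set V) : (G.induce X).arcs ⊆ G.arcs :=
  fun _ h => h.1

theorem induce_arcs_subset_around {G : LGraph V Γ} (X : Set V) :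
    (G.induce X).arcs ⊆ (G.around X).arcs :=
  fun _ h => ⟨h.1, .inl h.2.1, .inl h.2.2, fun h' => h'.1.1 h.2.1⟩

variable [DecidableEq V]

theorem stepLabel_symm {G : LGraph V Γ} {a : V × V × Γ} (ha : a ∈ G.arcs) {u v : V}
    (h : connects a u v) : stepLabel u a = (stepLabel v a)⁻¹ := by
  have := G.loopless a ha
  rcases h with ⟨rfl, rfl⟩ | ⟨rfl, rfl⟩ <;> simp [stepLabel, this.symm]

/-- Some edge of `G` joins `u` and `v` and contributes `γ` when traversed from `u` to `v`. -/
def HasStep (G : LGraph V Γ) (u v : V) (γ : Γ) : Prop :=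
  ∃ a ∈ G.arcs, connects a u v ∧ stepLabel v a = γ

/-- `G.Trace u w l γ` : some walk from `u` to `w` in `G` has vertex sequence `l` and label `γ`. -/
inductive Trace (G : LGraph V Γ) : V → V → List V → Γ → Prop
  | nil (v : V) : Trace G v v [v] 1
  | cons {u v w : V} {l : List V} {g γ : Γ} (hstep : G.HasStep u v g)
      (h : Trace G v w l γ) : Trace G u w (u :: l) (γ * g)

variable {G G' : LGraph V Γ}

theorem HasStep.symm {u v : V} {γ : Γ} (h : G.HasStep u v γ) : G.HasStep v u γ⁻¹ := by
  obtain ⟨a, ha, hc, rfl⟩ := h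
  exact ⟨a, ha, hc.symm, stepLabel_symm ha hc⟩

theorem HasStep.mono (hGG' : G.arcs ⊆ G'.arcs) {u v : V} {γ : Γ} (h : G.HasStep u v γ) :
    G'.HasStep u v γ := by
  obtain ⟨a, ha, h⟩ := h
  exact ⟨a, hGG' ha, h⟩

theorem hasStep_iff {u v : V} {γ : Γ} :
    G.HasStep u v γ ↔ hasEquivArc G.arcs u v γ := by
  constructor
  · rintro ⟨⟨p, q, g⟩, ha, hc, rfl⟩
    have := G.loopless _ ha
    rcases hc with ⟨rfl, rfl⟩ | ⟨rfl, rfl⟩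
    · left; simpa [stepLabel] using ha
    · right; simpa [stepLabel, this.symm] using ha
  · rintro (h | h)
    · exact ⟨_, h, .inl ⟨rfl, rfl⟩, by simp [stepLabel]⟩
    · have := G.loopless _ h
      exact ⟨_, h, .inr ⟨rfl, rfl⟩, by simp [stepLabel, this.symm]⟩

theorem Trace.mono (hGG' : G.arcs ⊆ G'.arcs) {u v : V} {l : List V} {γ : Γ}
    (h : G.Trace u v l γ) : G'.Trace u v l γ := by
  induction h with
  | nil v => exact .nil v
  | cons hs _ ih => exact .cons (hs.mono hGG') ih

theorem Trace.head_mem {u v : V} {l : List V} {γ : Γ} (h : G.Trace u v l γ) : u ∈ l := by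
  cases h <;> simp

theorem Trace.last_mem {u v : V} {l : List V} {γ : Γ} (h : G.Trace u v l γ) : v ∈ l := by
  induction h <;> simp_all

theorem Trace.append {u p q w : V} {l₁ l₂ : List V} {γ₁ g γ₂ : Γ} (h₁ : G.Trace u p l₁ γ₁)
    (hs : G.HasStep p q g) (h₂ : G.Trace q w l₂ γ₂) :
    G.Trace u w (l₁ ++ l₂) (γ₂ * g * γ₁) := by
  induction h₁ with
  | nil v => simpa using Trace.cons hs h₂
  | cons hs' _ ih => simpa [mul_assoc] using Trace.cons hs' (ih hs)

theorem Trace.trans {u p w : V} {l₁ l₂ : List V} {γ₁ γ₂ : Γ} (h₁ : G.Trace u p l₁ γ₁)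
    (h₂ : G.Trace p w l₂ γ₂) : ∃ l, G.Trace u w l (γ₂ * γ₁) := by
  induction h₁ with
  | nil v => exact ⟨l₂, by simpa using h₂⟩
  | cons hs _ ih =>
    obtain ⟨l, hl⟩ := ih h₂
    exact ⟨_, by simpa [mul_assoc] using Trace.cons hs hl⟩

theorem Trace.symm {u w : V} {l : List V} {γ : Γ} (h : G.Trace u w l γ) :
    ∃ l', G.Trace w u l' γ⁻¹ := by
  induction h with
  | nil v => exact ⟨_, by simpa using Trace.nil v⟩
  | @cons u v w l g γ hs _ ih =>
    obtain ⟨l', hl'⟩ := ih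
    exact ⟨_, by simpa [mul_assoc] using hl'.append hs.symm (.nil u)⟩

theorem Trace.exists_suffix {v w u : V} {l : List V} {γ : Γ} (h : G.Trace v w l γ)
    (hu : u ∈ l) : ∃ l' γ', l' <:+ l ∧ G.Trace u w l' γ' := by
  induction h with
  | nil v =>
    obtain rfl : u = v := by simpa using hu
    exact ⟨_, _, List.suffix_rfl, .nil u⟩
  | @cons v v' w l g γ hs h ih =>
    rcases List.mem_cons.1 hu with rfl | hu
    · exact ⟨_, _, List.suffix_rfl, .cons hs h⟩
    · obtain ⟨l', γ', hl', h'⟩ := ih hu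
      exact ⟨l', γ', hl'.trans (List.suffix_cons _ _), h'⟩

theorem Trace.exists_nodup {u w : V} {l : List V} {γ : Γ} (h : G.Trace u w l γ) :
    ∃ l' γ', l'.Nodup ∧ l' ⊆ l ∧ G.Trace u w l' γ' := by
  induction h with
  | nil v => exact ⟨_, _, by simp, List.Subset.refl _, .nil v⟩
  | @cons u v w l g γ hs _ ih =>
    obtain ⟨l', γ', hnd, hsub, h'⟩ := ih
    by_cases hu : u ∈ l'
    · obtain ⟨l'', γ'', hl'', h''⟩ := h'.exists_suffix hu
      exact ⟨l'', γ'', hnd.sublist hl''.sublist,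
        fun _ hx => List.mem_cons_of_mem _ (hsub (hl''.subset hx)), h''⟩
    · exact ⟨_, _, List.nodup_cons.2 ⟨hu, hnd⟩, List.cons_subset_cons _ hsub, .cons hs h'⟩

theorem Walk.trace {u w : V} (W : G.Walk u w) : G.Trace u w W.support W.label := by
  induction W with
  | nil v => exact .nil v
  | cons u v a ha hstep W ih => exact .cons ⟨a, ha, hstep, rfl⟩ ih

theorem Trace.exists_walk {u w : V} {l : List V} {γ : Γ} (h : G.Trace u w l γ) :
    ∃ W : G.Walk u w, W.support = l ∧ W.label = γ := by
  induction h with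
  | nil v => exact ⟨.nil v, rfl, rfl⟩
  | @cons u v w l g γ hs _ ih =>
    obtain ⟨a, ha, hc, rfl⟩ := hs
    obtain ⟨W, rfl, rfl⟩ := ih
    exact ⟨.cons u v a ha hc W, rfl, rfl⟩

theorem mem_labelSet_iff {s t : V} {γ : Γ} :
    γ ∈ labelSet G s t ↔ ∃ l : List V, l.Nodup ∧ G.Trace s t l γ := by
  constructor
  · rintro ⟨P, hP, rfl⟩
    exact ⟨_, hP, P.trace⟩
  · rintro ⟨l, hl, h⟩
    obtain ⟨W, rfl, rfl⟩ := h.exists_walk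
    exact ⟨W, hl, rfl⟩

namespace Walk

theorem IsPath.label_eq_one_s5 {v : V} {P : G.Walk v v} (hP : P.IsPath) : P.label = 1 := by
  cases P with
  | nil => rfl
  | cons _ v' a ha hs W => exact absurd W.end_mem_support_s5 (List.nodup_cons.1 hP).1

theorem IsPath.label_eq_stepLabel {v u : V} {P : G.Walk v u} (hP : P.IsPath) {a : V × V × Γ}
    (ha : a ∈ P.arcsList) (hc : connects a v u) : P.label = stepLabel u a := by
  cases P with
  | nil => simp [arcsList] at ha
  | cons _ v' b hb hs W =>
    have h := List.nodup_cons.1 hP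
    rcases List.mem_cons.1 ha with rfl | ha
    · obtain rfl := hs.right_unique hc
      have hW : W.IsPath := h.2
      simp [label, hW.label_eq_one_s5]
    · exact absurd (left_mem_support_of_mem_arcsList ha hc) h.1

theorem IsPath.exists_split {v w u : V} {P : G.Walk v w} (hP : P.IsPath)
    (hu : u ∈ P.support) : ∃ (P₁ : G.Walk v u) (P₂ : G.Walk u w), P₁.IsPath ∧ P₂.IsPath ∧
      P₁.support ⊆ P.support ∧ P.label = P₂.label * P₁.label := by
  induction P with
  | nil v =>
    obtain rfl : u = v := by simpa [support] using hu
    exact ⟨.nil u, .nil u, hP, hP, List.Subset.refl _, by simp [label]⟩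
  | @cons v v' w b hb hs W ih =>
    have h := List.nodup_cons.1 hP
    by_cases huv : u = v
    · subst huv
      exact ⟨.nil u, .cons u v' b hb hs W, by simp [IsPath, support], hP,
        by simp [support], by simp [label]⟩
    · obtain ⟨P₁, P₂, h₁, h₂, hsub, hl⟩ := ih h.2 ((List.mem_cons.1 hu).resolve_left huv)
      exact ⟨.cons v v' b hb hs P₁, P₂, List.nodup_cons.2 ⟨fun hm => h.1 (hsub hm), h₁⟩, h₂,
        List.cons_subset_cons _ hsub, by simp [label, hl, mul_assoc]⟩

/-- Closing up a path by an edge gives label `1` in a balanced graph, also when the edge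
is the path itself. -/
theorem IsPath.label_mul_stepLabel (hbal : G.Balanced) {u v : V} {P : G.Walk v u}
    (hP : P.IsPath) {a : V × V × Γ} (ha : a ∈ G.arcs) (hc : connects a u v) :
    P.label * stepLabel v a = 1 := by
  by_cases hm : a ∈ P.arcsList
  · rw [hP.label_eq_stepLabel hm hc.symm, stepLabel_symm ha hc, inv_mul_cancel]
  · refine hbal u (.cons u v a ha hc P) ⟨by simp [length],
      List.nodup_cons.2 ⟨hm, hP.arcsList_nodup_s5⟩, ?_⟩
    rw [support, List.dropLast_cons_of_ne_nil P.support_ne_nil]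
    have hnd : P.support.Nodup := hP
    rw [P.support_eq_dropLast_append_s5, List.nodup_append] at hnd
    exact List.nodup_cons.2 ⟨fun h => hnd.2.2 u h u (by simp) rfl, hnd.1⟩

theorem exists_isPath_label_eq (hbal : G.Balanced) {u w : V} (W : G.Walk u w) :
    ∃ P : G.Walk u w, P.IsPath ∧ P.label = W.label := by
  induction W with
  | nil v => exact ⟨.nil v, by simp [IsPath, support], rfl⟩
  | cons u v a ha hc W ih =>
    obtain ⟨P, hP, hl⟩ := ih
    by_cases hu : u ∈ P.support
    · obtain ⟨P₁, P₂, h₁, h₂, -, hl'⟩ := hP.exists_split hu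
      refine ⟨P₂, h₂, ?_⟩
      rw [label, ← hl, hl', mul_assoc, h₁.label_mul_stepLabel hbal ha hc, mul_one]
    · exact ⟨.cons u v a ha hc P, List.nodup_cons.2 ⟨hu, hP⟩, by rw [label, label, hl]⟩

end Walk

theorem Balanced.mem_labelSet (hbal : G.Balanced) {u w : V} {l : List V} {γ : Γ}
    (h : G.Trace u w l γ) : γ ∈ labelSet G u w := by
  obtain ⟨W, -, rfl⟩ := h.exists_walk
  exact W.exists_isPath_label_eq hbal

theorem Balanced.label_unique (hbal : G.Balanced) {u w : V} {l l' : List V} {γ γ' : Γ}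
    (h : G.Trace u w l γ) (h' : G.Trace u w l' γ') : γ = γ' := by
  obtain ⟨l₁, h₁⟩ := h'.symm
  obtain ⟨l₂, h₂⟩ := h.trans h₁
  obtain ⟨P, hP, hl⟩ := hbal.mem_labelSet h₂
  rw [hP.label_eq_one_s5] at hl
  exact (inv_mul_eq_one.1 hl.symm).symm

theorem HasStep.mem_nbhd {X : Set V} {u v : V} {g : Γ} (h : G.HasStep u v g) (hu : u ∈ X)
    (hv : v ∉ X) : v ∈ G.nbhd X := by
  obtain ⟨a, ha, hc, -⟩ := h
  exact ⟨hv, u, hu, a, ha, hc⟩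

theorem exists_hasStep_of_mem_nbhd {X : Set V} {v : V} (hv : v ∈ G.nbhd X) :
    ∃ u ∈ X, ∃ g, G.HasStep u v g := by
  obtain ⟨-, u, hu, a, ha, hc⟩ := hv
  exact ⟨u, hu, _, a, ha, hc, rfl⟩

theorem HasStep.around {X : Set V} {u v : V} {g : Γ} (h : G.HasStep u v g) (hu : u ∈ X) :
    (G.around X).HasStep u v g := by
  have hv : v ∈ X ∪ G.nbhd X := by
    by_cases hv : v ∈ X
    · exact .inl hv
    · exact .inr (h.mem_nbhd hu hv)
  obtain ⟨a, ha, hc, hg⟩ := h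
  refine ⟨a, ⟨ha, ?_⟩, hc, hg⟩
  rcases hc with ⟨rfl, rfl⟩ | ⟨rfl, rfl⟩
  · exact ⟨.inl hu, hv, fun h' => h'.1.1 hu⟩
  · exact ⟨hv, .inl hu, fun h' => h'.2.1 hu⟩

theorem Trace.subset_of_induce {X : Set V} {u w : V} {l : List V} {γ : Γ}
    (h : (G.induce X).Trace u w l γ) (hu : u ∈ X) : ∀ v ∈ l, v ∈ X := by
  induction h with
  | nil v => simpa using hu
  | @cons u v w l g γ hs _ ih =>
    obtain ⟨a, ha, hc, -⟩ := hs
    have hv : v ∈ X := by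
      rcases hc with ⟨rfl, rfl⟩ | ⟨rfl, rfl⟩
      · exact ha.2.2
      · exact ha.2.1
    intro v' hv'
    rcases List.mem_cons.1 hv' with rfl | hv'
    · exact hu
    · exact ih hv v' hv'

/-- `G.Bridge X u w κ` : `u` and `w` are distinct neighbours of `X`, and some walk between
them in `G.around X` has label `κ`. -/
def Bridge (G : LGraph V Γ) (X : Set V) (u w : V) (κ : Γ) : Prop :=
  u ∈ G.nbhd X ∧ w ∈ G.nbhd X ∧ u ≠ w ∧ ∃ l, (G.around X).Trace u w l κ

theorem Bridge.symm {X : Set V} {u w : V} {κ : Γ} (h : G.Bridge X u w κ) :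
    G.Bridge X w u κ⁻¹ := by
  obtain ⟨hu, hw, hne, l, hl⟩ := h
  exact ⟨hw, hu, hne.symm, hl.symm⟩

/-- The steps of `H` are the steps of `G` avoiding `X` together with the bridges over `X`. -/
def IsContraction (G H : LGraph V Γ) (X : Set V) : Prop :=
  ∀ u v γ, H.HasStep u v γ ↔
    (u ∉ X ∧ v ∉ X ∧ G.HasStep u v γ) ∨ G.Bridge X u v γ

theorem hasEquivArc_keptArcs {X : Set V} {u v : V} {γ : Γ} :
    hasEquivArc (G.keptArcs X) u v γ ↔ u ∉ X ∧ v ∉ X ∧ G.HasStep u v γ := by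
  rw [hasStep_iff]
  simp only [hasEquivArc, keptArcs, Set.mem_ofPred_eq]
  tauto

theorem isContraction_of_arcs_eq {H : LGraph V Γ} {X : Set V} {x y z : V}
    (hxy : x ≠ y) (hxz : x ≠ z) (hyz : y ≠ z) (hN : G.nbhd X = {x, y, z})
    (hbal : (G.around X).Balanced) (hHa : H.arcs = G.contract3Arcs X x y z) :
    G.IsContraction H X := by
  have hx : x ∈ G.nbhd X := by simp [hN]
  have hy : y ∈ G.nbhd X := by simp [hN]
  have hz : z ∈ G.nbhd X := by simp [hN]
  have hnew : ∀ p q, p ≠ q → p ∈ G.nbhd X → q ∈ G.nbhd X → ∀ u v γ,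
      (u, v, γ) ∈ G.newContractionArcs X p q → G.Bridge X u v γ := by
    rintro p q hpq hp hq u v γ ⟨γ', hγ', he, -⟩
    obtain ⟨rfl, rfl, rfl⟩ : u = p ∧ v = q ∧ γ = γ' := by simpa using he
    obtain ⟨l, -, hl⟩ := mem_labelSet_iff.1 hγ'
    exact ⟨hp, hq, hpq, l, hl⟩
  have harc : ∀ u v γ, (u, v, γ) ∈ H.arcs →
      (u, v, γ) ∈ G.keptArcs X ∨ G.Bridge X u v γ := by
    intro u v γ h
    rw [hHa] at h
    rcases h with ((h | h) | h) | h
    · exact .inl h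
    · exact .inr (hnew _ _ hxy hx hy _ _ _ h)
    · exact .inr (hnew _ _ hyz hy hz _ _ _ h)
    · exact .inr (hnew _ _ hxz hx hz _ _ _ h)
  have hkept : ∀ u v γ, hasEquivArc (G.keptArcs X) u v γ → H.HasStep u v γ := by
    intro u v γ h
    rw [hasStep_iff, hHa]
    exact h.imp (fun h => .inl (.inl (.inl h))) (fun h => .inl (.inl (.inl h)))
  have hadd : ∀ p q, G.newContractionArcs X p q ⊆ H.arcs → ∀ κ, G.Bridge X p q κ →
      H.HasStep p q κ := by
    rintro p q hsub κ ⟨hp, hq, hpq, l, hl⟩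
    by_cases he : hasEquivArc (G.keptArcs X) p q κ
    · exact hkept _ _ _ he
    · exact hasStep_iff.2 (.inl (hsub ⟨κ, hbal.mem_labelSet hl, rfl, he⟩))
  have hsxy : G.newContractionArcs X x y ⊆ H.arcs := by
    rw [hHa]; exact fun _ h => .inl (.inl (.inr h))
  have hsyz : G.newContractionArcs X y z ⊆ H.arcs := by
    rw [hHa]; exact fun _ h => .inl (.inr h)
  have hsxz : G.newContractionArcs X x z ⊆ H.arcs := by
    rw [hHa]; exact fun _ h => .inr h
  intro u v γ
  constructor
  · intro h
    rw [← hasEquivArc_keptArcs]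
    rcases hasStep_iff.1 h with h | h
    · exact (harc _ _ _ h).imp_left .inl
    · exact (harc _ _ _ h).imp .inr fun h => by simpa using h.symm
  · rintro (h | h)
    · exact hkept _ _ _ (hasEquivArc_keptArcs.2 h)
    · have hflip : ∀ p q, G.newContractionArcs X p q ⊆ H.arcs → ∀ κ, G.Bridge X q p κ →
          H.HasStep q p κ := fun p q hs κ hB => by
        simpa using (hadd p q hs _ hB.symm).symm
      obtain ⟨hu, hv, hne, -⟩ := id h
      rw [hN] at hu hv
      rcases hu with rfl | rfl | rfl <;> rcases hv with rfl | rfl | rfl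
      · exact absurd rfl hne
      · exact hadd _ _ hsxy _ h
      · exact hadd _ _ hsxz _ h
      · exact hflip _ _ hsxy _ h
      · exact absurd rfl hne
      · exact hadd _ _ hsyz _ h
      · exact hflip _ _ hsxz _ h
      · exact hflip _ _ hsyz _ h
      · exact absurd rfl hne

theorem noEquivArcs_of_arcs_eq {H : LGraph V Γ} {X : Set V} {x y z : V}
    (hxy : x ≠ y) (hxz : x ≠ z) (hyz : y ≠ z) (hG : G.NoEquivArcs)
    (hHa : H.arcs = G.contract3Arcs X x y z) : H.NoEquivArcs := by
  rintro ⟨u, v, g⟩ ha ⟨u', v', g'⟩ hb hne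
  rw [hHa] at ha hb
  rintro (⟨h₁, h₂, h₃⟩ | ⟨h₁, h₂, h₃⟩)
  · exact hne (by simp_all)
  · dsimp only at h₁ h₂ h₃
    subst h₁ h₂ h₃
    rcases ha with ((ha | ⟨γ, -, he, hk⟩) | ⟨γ, -, he, hk⟩) | ⟨γ, -, he, hk⟩ <;>
    rcases hb with ((hb | ⟨γ', -, he', hk'⟩) | ⟨γ', -, he', hk'⟩) | ⟨γ', -, he', hk'⟩ <;>
    first
      | exact hG _ ha.1 _ hb.1 hne (.inr ⟨rfl, rfl, rfl⟩)
      | (cases he; exact hk (.inr (by simpa using hb)))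
      | (cases he'; exact hk' (.inr ha))
      | (simp only [Prod.mk.injEq] at he he'; grind)

/-- A path of `G` contracts to a path of `H`; when it starts inside `X`, it does so after the
first exit from `X`. -/
theorem IsContraction.exists_trace_contract {H : LGraph V Γ} {X : Set V}
    (hH : G.IsContraction H X) {u t : V} {l : List V} {γ : Γ} (h : G.Trace u t l γ)
    (hnd : l.Nodup) (ht : t ∉ X) :
    (u ∉ X → ∃ l', l'.Sublist l ∧ (∀ v ∈ l, v ∉ X → v ∈ l') ∧ H.Trace u t l' γ) ∧
    (u ∈ X → ∃ w l₁ l' γ₁ γ₂, w ∈ G.nbhd X ∧ (G.around X).Trace u w l₁ γ₁ ∧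
      l'.Sublist l ∧ (∀ v ∈ l, v ∉ X → v ∈ l') ∧ H.Trace w t l' γ₂ ∧ γ = γ₂ * γ₁) := by
  induction h with
  | nil v => exact ⟨fun _ => ⟨_, .refl _, fun _ h _ => h, .nil v⟩, fun h => absurd h ht⟩
  | @cons u v t l g γ hs h ih =>
    obtain ⟨hul, hnd⟩ := List.nodup_cons.1 hnd
    obtain ⟨ihout, ihin⟩ := ih hnd ht
    constructor
    · intro hu
      by_cases hv : v ∈ X
      · obtain ⟨w, l₁, l', γ₁, γ₂, hw, hl₁, hsub, hmem, hl', rfl⟩ := ihin hv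
        have hne : u ≠ w := fun h => hul (h ▸ hsub.subset hl'.head_mem)
        have hstep := hs.symm.around hv
        have hB : G.Bridge X u w (γ₁ * g) :=
          ⟨hs.symm.mem_nbhd hv hu, hw, hne, _, .cons (by simpa using hstep.symm) hl₁⟩
        refine ⟨u :: l', hsub.cons_cons u, ?_, ?_⟩
        · grind
        · rw [mul_assoc]
          exact .cons ((hH _ _ _).2 (.inr hB)) hl'
      · obtain ⟨l', hsub, hmem, hl'⟩ := ihout hv
        exact ⟨u :: l', hsub.cons_cons u, by grind, .cons ((hH _ _ _).2 (.inl ⟨hu, hv, hs⟩)) hl'⟩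
    · intro hu
      by_cases hv : v ∈ X
      · obtain ⟨w, l₁, l', γ₁, γ₂, hw, hl₁, hsub, hmem, hl', rfl⟩ := ihin hv
        exact ⟨w, _, l', _, γ₂, hw, .cons (hs.around hu) hl₁, hsub.cons u, by grind, hl',
          mul_assoc _ _ _⟩
      · obtain ⟨l', hsub, hmem, hl'⟩ := ihout hv
        exact ⟨v, _, l', _, γ, hs.mem_nbhd hu hv, .cons (hs.around hu) (.nil v), hsub.cons u,
          by grind, hl', by simp⟩

/-- A path of the contraction is a path of `G` avoiding `X`, possibly with a single bridge
over `X` once consecutive bridges are merged. -/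
theorem IsContraction.trace_or_bridge {H : LGraph V Γ} {X : Set V} {x y z : V}
    (hN : G.nbhd X = {x, y, z}) (hH : G.IsContraction H X) {u t : V} {l : List V} {γ : Γ}
    (h : H.Trace u t l γ) (hnd : l.Nodup) (ht : t ∉ X) :
    (∀ v ∈ l, v ∉ X) ∧ (G.Trace u t l γ ∨
      ∃ p q l₁ l₂ γ₁ κ γ₂, G.Bridge X p q κ ∧ G.Trace u p l₁ γ₁ ∧ G.Trace q t l₂ γ₂ ∧
        (l₁ ++ l₂).Sublist l ∧ γ = γ₂ * κ * γ₁) := by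
  induction h with
  | nil v => exact ⟨by simpa using ht, .inl (.nil v)⟩
  | @cons u v t l g γ hs h ih =>
    obtain ⟨hul, hnd⟩ := List.nodup_cons.1 hnd
    obtain ⟨hout, ih⟩ := ih hnd ht
    rcases (hH _ _ _).1 hs with ⟨hu, hv, hs⟩ | hB
    · refine ⟨by simpa [hu] using hout, ?_⟩
      rcases ih with ih | ⟨p, q, l₁, l₂, γ₁, κ, γ₂, hB, h₁, h₂, hsub, rfl⟩
      · exact .inl (.cons hs ih)
      · exact .inr ⟨p, q, _, l₂, _, κ, γ₂, hB, .cons hs h₁, h₂, hsub.cons_cons u,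
          by simp [mul_assoc]⟩
    · refine ⟨by simpa [hB.1.1] using hout, .inr ?_⟩
      rcases ih with ih | ⟨p, q, l₁, l₂, γ₁, κ, γ₂, hB', h₁, h₂, hsub, rfl⟩
      · exact ⟨u, v, [u], l, 1, g, γ, hB, .nil u, ih, .refl _, by simp⟩
      · have hnd' := hnd.sublist hsub
        have hup : u ≠ p := fun h =>
          hul (h ▸ hsub.subset (List.mem_append_left _ h₁.last_mem))
        have huq : u ≠ q := fun h =>
          hul (h ▸ hsub.subset (List.mem_append_right _ h₂.head_mem))
        have hvq : v ≠ q := fun h =>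
          (List.nodup_append.1 hnd').2.2 _ h₁.head_mem _ h₂.head_mem h
        obtain ⟨hu, hv, huv, k, hk⟩ := hB
        obtain ⟨hp, hq, hpq, k', hk'⟩ := hB'
        have hvp : v = p := by
          rw [hN] at hu hv hp hq
          simp only [Set.mem_insert_iff, Set.mem_singleton_iff] at hu hv hp hq
          grind
        subst hvp
        have hγ₁ : γ₁ = 1 := by
          obtain ⟨W, rfl, rfl⟩ := h₁.exists_walk
          exact Walk.IsPath.label_eq_one_s5 (List.nodup_append.1 hnd').1
        subst hγ₁
        exact ⟨u, q, [u], l₂, 1, κ * g, γ₂, ⟨hu, hq, huq, hk.trans hk'⟩, .nil u, h₂,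
          ((List.sublist_append_right _ _).trans hsub).cons_cons u, by simp [mul_assoc]⟩

theorem IsContraction.exists_trace_expand {H : LGraph V Γ} {X : Set V} {x y z : V}
    (hN : G.nbhd X = {x, y, z}) (hX : X ⊆ G.verts) (hconn : (G.induce X).Connected)
    (hbal : (G.around X).Balanced) (hH : G.IsContraction H X) {u t : V} {l : List V} {γ : Γ}
    (h : H.Trace u t l γ) (hnd : l.Nodup) (ht : t ∉ X) :
    ∃ l', l'.Nodup ∧ G.Trace u t l' γ := by
  obtain ⟨hout, h | ⟨p, q, l₁, l₂, γ₁, κ, γ₂, hB, h₁, h₂, hsub, rfl⟩⟩ :=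
    hH.trace_or_bridge hN h hnd ht
  · exact ⟨l, hnd, h⟩
  obtain ⟨hp, hq, -, k, hk⟩ := hB
  obtain ⟨p', hp', g, hg⟩ := exists_hasStep_of_mem_nbhd hp
  obtain ⟨q', hq', g', hg'⟩ := exists_hasStep_of_mem_nbhd hq
  obtain ⟨W⟩ := hconn p' ⟨hX hp', hp'⟩ q' ⟨hX hq', hq'⟩
  obtain ⟨m, δ, hmnd, -, hm⟩ := W.trace.exists_nodup
  have hmX := hm.subset_of_induce hp'
  have haround := (Trace.nil p).append (hg.around hp').symm
    ((hm.mono (induce_arcs_subset_around X)).append (hg'.around hq') (.nil q))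
  obtain rfl := hbal.label_unique hk haround
  refine ⟨l₁ ++ (m ++ l₂), ?_, ?_⟩
  · have hnd' := hnd.sublist hsub
    have hdisj : ∀ v ∈ m, v ∉ l₁ ++ l₂ := fun v hv hv' => hout v (hsub.subset hv') (hmX v hv)
    clear * - hnd' hdisj hmnd
    simp only [List.nodup_append, List.mem_append] at hnd' hdisj ⊢
    grind
  · have := h₁.append hg.symm ((hm.mono (induce_arcs_subset X)).append hg' h₂)
    simpa [mul_assoc] using this

end LGraph

open LGraph in
/-- For `(G, s, t) ∈ 𝒟` and a 3-contractible vertex set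
`X ⊆ V(G)∖{s,t}` with `N_G(X) = {x, y, z}`, the 3-contraction `H = G /₃ X`
satisfies `(H, s, t) ∈ 𝒟` and `l(H; s, t) = l(G; s, t)`. -/
theorem three_contraction_preserves {V Γ : Type} [Group Γ] [DecidableEq V]
    (G H : LGraph V Γ) (s t : V) (X : Set V) (x y z : V)
    (hD : G.MemD s t)
    (hX : X ⊆ G.verts \ {s, t})
    (hxy : x ≠ y) (hxz : x ≠ z) (hyz : y ≠ z)
    (hN : G.nbhd X = {x, y, z})
    (hconn : (G.induce X).Connected)
    (hbal : (G.around X).Balanced)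
    (hHv : H.verts = G.verts \ X)
    (hHa : H.arcs = G.contract3Arcs X x y z) :
    H.MemD s t ∧ labelSet H s t = labelSet G s t := by
  obtain ⟨hst, hs, ht, hpath, hequiv⟩ := hD
  have hsX : s ∉ X := fun h => (hX h).2 (by simp)
  have htX : t ∉ X := fun h => (hX h).2 (by simp)
  have hH : G.IsContraction H X := isContraction_of_arcs_eq hxy hxz hyz hN hbal hHa
  refine ⟨⟨hst, hHv ▸ ⟨hs, hsX⟩, hHv ▸ ⟨ht, htX⟩, fun v hv => ?_,
    noEquivArcs_of_arcs_eq hxy hxz hyz hequiv hHa⟩, ?_⟩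
  · rw [hHv] at hv
    obtain ⟨P, hP, hvP⟩ := hpath v hv.1
    obtain ⟨l, hsub, hmem, hl⟩ := (hH.exists_trace_contract P.trace hP htX).1 hsX
    obtain ⟨Q, rfl, -⟩ := hl.exists_walk
    exact ⟨Q, List.Nodup.sublist hsub hP, hmem v hvP hv.2⟩
  · ext γ
    rw [mem_labelSet_iff, mem_labelSet_iff]
    constructor
    · rintro ⟨l, hnd, hl⟩
      exact hH.exists_trace_expand hN (fun _ h => (hX h).1) hconn hbal hl hnd htX
    · rintro ⟨l, hnd, hl⟩
      obtain ⟨l', hsub, -, hl'⟩ := (hH.exists_trace_contract hl hnd htX).1 hsX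
      exact ⟨l', hnd.sublist hsub, hl'⟩
end
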